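/- A rank r is typical for real binary forms of degree d (i.e., the set of forms of real rank exactly r has nonempty interior in the Euclidean topology on ℝ[x,y]_d) if and only if (d+1)/2 ≤ r ≤ d. -/

import Mathlib

open MvPolynomial

noncomputable section

/-- The Zariski closure of a subset of the affine space `σ → K`. -/
def zClosure {K : Type} [Field K] {σ : Type} [Fintype σ] [DecidableEq σ]
    (S : Set (σ → K)) : Set (σ → K) :=
  {x | ∀ p : MvPolynomial σ K, (∀ y ∈ S, eval y p = 0) → eval x p = 0}

/-- A subset of affine space is Zariski closed if it equals its Zariski closure. -/
def zClosed {K : Type} [Field K] {σ : Type} [Fintype σ] [DecidableEq σ]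
    (S : Set (σ → K)) : Prop :=
  zClosure S = S

/-- Irreducibility of a subset of affine space in the Zariski topology,
tested against the basic open sets. -/
def zIrreducible {K : Type} [Field K] {σ : Type} [Fintype σ] [DecidableEq σ]
    (S : Set (σ → K)) : Prop :=
  S.Nonempty ∧ ∀ p q : MvPolynomial σ K,
    (∀ x ∈ S, eval x p = 0 ∨ eval x q = 0) →
    (∀ x ∈ S, eval x p = 0) ∨ (∀ x ∈ S, eval x q = 0)

/-- There is a strictly increasing chain of `m+1` irreducible Zariski-closed
subsets contained in `S`. -/
def zChain {K : Type} [Field K] {σ : Type} [Fintype σ] [DecidableEq σ]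
    (S : Set (σ → K)) (m : ℕ) : Prop :=
  ∃ c : Fin (m+1) → Set (σ → K),
    (∀ i, zIrreducible (c i) ∧ zClosed (c i) ∧ c i ⊆ S) ∧
    ∀ i j : Fin (m+1), i < j → c i ⊂ c j

/-- `S` has (Krull) dimension `m` in the Zariski topology. -/
def zDimEq {K : Type} [Field K] {σ : Type} [Fintype σ] [DecidableEq σ]
    (S : Set (σ → K)) (m : ℕ) : Prop :=
  zChain S m ∧ ¬ zChain S (m+1)

/-- The (embedded, affine) Zariski tangent space to `S` at `a`: the common kernel of the
differentials at `a` of all polynomials vanishing on `S`. -/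
def zTangentAt {K : Type} [Field K] {σ : Type} [Fintype σ] [DecidableEq σ]
    (S : Set (σ → K)) (a : σ → K) : Set (σ → K) :=
  {v | ∀ p : MvPolynomial σ K, (∀ y ∈ S, eval y p = 0) →
        ∑ i : σ, eval a (pderiv i p) * v i = 0}

/-- Dimension of the Zariski tangent space at a point. -/
def zTangentDim {K : Type} [Field K] {σ : Type} [Fintype σ] [DecidableEq σ]
    (S : Set (σ → K)) (a : σ → K) : ℕ :=
  Module.finrank K (Submodule.span K (zTangentAt S a))

/-- The binary form of degree `r` with coefficient vector `a`. -/
def binForm {K : Type} [CommSemiring K] (r : ℕ) (a : Fin (r+1) → K) :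
    MvPolynomial (Fin 2) K :=
  ∑ i : Fin (r+1), C (a i) * X 0 ^ (r - (i : ℕ)) * X 1 ^ (i : ℕ)

/-- The linear binary form `u·x + v·y`. -/
def linForm {K : Type} [CommSemiring K] (u v : K) : MvPolynomial (Fin 2) K :=
  C u * X 0 + C v * X 1

/-- The affine cone over the coincident root locus `Δ_λ ⊆ ℙ^r`, in coefficient coordinates:
scalar multiples of forms `∏ ℓ_i ^ λ_i`. -/
def crlCone (r n : ℕ) (lam : Fin n → ℕ) : Set (Fin (r+1) → ℂ) :=
  {a | ∃ (t : ℂ) (u v : Fin n → ℂ),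
    binForm r a = C t * ∏ i, (linForm (u i) (v i)) ^ lam i}

/-- `lam` is a partition of `r` of length `n` (all parts positive). -/
def isPartitionOf (r n : ℕ) (lam : Fin n → ℕ) : Prop :=
  (∀ i, 1 ≤ lam i) ∧ ∑ i, lam i = r

/-- The multiplicity `m_j` of the part `j` in the partition `lam`. -/
def multOf {n : ℕ} (lam : Fin n → ℕ) (jj : ℕ) : ℕ :=
  (Finset.univ.filter fun i => lam i = jj).card

/-- The differential operator of degree `s` with coefficient vector `b`, i.e.
`∑ b_i ∂x^(s-i) ∂y^i`, applied to `f`. -/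
def diffOp {K : Type} [CommSemiring K] (s : ℕ) (b : Fin (s+1) → K)
    (f : MvPolynomial (Fin 2) K) : MvPolynomial (Fin 2) K :=
  ∑ i : Fin (s+1), b i •
    ((fun g => pderiv (0 : Fin 2) g)^[s - (i : ℕ)]
      (((fun g => pderiv (1 : Fin 2) g)^[(i : ℕ)]) f))

/-- The apolarity pairing between a degree-`d` operator (coefficients `h`) and a
degree-`d` form (coefficients `a`). -/
def apolarPair (d : ℕ) (h a : Fin (d+1) → ℂ) : ℂ :=
  eval (fun _ => (0 : ℂ)) (diffOp d h (binForm d a))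

/-- The cone over the dual variety of the cone `S ⊆ ℂ^(m+1)` (with `k` the dimension of the
cone `S`, used to select smooth points): closure of the set of hyperplanes, written in dual
coordinates via the apolarity pairing, containing an embedded tangent space at a smooth point. -/
def dualConeOf (m : ℕ) (S : Set (Fin (m+1) → ℂ)) (k : ℕ) : Set (Fin (m+1) → ℂ) :=
  zClosure {h | h ≠ 0 ∧ ∃ a ∈ S, a ≠ 0 ∧ zTangentDim S a = k ∧
      ∀ v ∈ zTangentAt S a, apolarPair m h v = 0}

/-- The row span of a matrix, as a subspace of `ℂ^m`. -/
def rowSpan {k m : ℕ} (M : Matrix (Fin k) (Fin m) ℂ) : Submodule ℂ (Fin m → ℂ) :=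
  Submodule.span ℂ (Set.range fun i => M i)

/-- The (redundant) Plücker coordinate vector of the row span of `M`: all maximal minors. -/
def plucker {k m : ℕ} (M : Matrix (Fin k) (Fin m) ℂ) : (Fin k → Fin m) → ℂ :=
  fun s => (M.submatrix id s).det

/-- The degree-`s` component of the apolar ideal of the degree-`d` form with
coefficients `a`, as a subset of the coefficient space of operators. -/
def apolarSet (d s : ℕ) (a : Fin (d+1) → ℂ) : Set (Fin (s+1) → ℂ) :=
  {b | diffOp s b (binForm d a) = 0}

/-- The (pre-closure) cone, in Plücker coordinates, over the `j`-th higher associated variety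
`CH_j(S)`: spans of `k`-row matrices whose row space contains a smooth point `x` of the cone
`S` (`dimS` = dimension of the cone `S`) and meets the tangent space at `x` in projective
dimension at least `j`. -/
def smoothCHCone (m : ℕ) (S : Set (Fin (m+1) → ℂ)) (dimS k j : ℕ) :
    Set ((Fin k → Fin (m+1)) → ℂ) :=
  {u | ∃ M : Matrix (Fin k) (Fin (m+1)) ℂ, u = plucker M ∧
    Module.finrank ℂ (rowSpan M) = k ∧
    ∃ x, x ≠ 0 ∧ x ∈ S ∧ zTangentDim S x = dimS ∧ x ∈ rowSpan M ∧
      j + 1 ≤ Module.finrank ℂ ↥(rowSpan M ⊓ Submodule.span ℂ (zTangentAt S x))}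

/-- The (pre-closure) cone, in Plücker coordinates, over `Ξ_0(S)`: spans of `k`-row matrices
whose row space meets the cone `S` nontrivially. -/
def meetCone (m : ℕ) (S : Set (Fin (m+1) → ℂ)) (k : ℕ) :
    Set ((Fin k → Fin (m+1)) → ℂ) :=
  {u | ∃ M : Matrix (Fin k) (Fin (m+1)) ℂ, u = plucker M ∧
    Module.finrank ℂ (rowSpan M) = k ∧ ∃ x, x ≠ 0 ∧ x ∈ S ∧ x ∈ rowSpan M}

/-- The preimage under the apolar map `Ψ_{d,s}` of a subset `T` of the Grassmannian
(in Plücker coordinates) of `(k-1)`-projective-dimensional subspaces of `ℙ(D_s)`. -/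
def apolarPull (d s k : ℕ) (T : Set ((Fin k → Fin (s+1)) → ℂ)) : Set (Fin (d+1) → ℂ) :=
  {a | ∃ M : Matrix (Fin k) (Fin (s+1)) ℂ,
    rowSpan M = Submodule.span ℂ (apolarSet d s a) ∧
    Module.finrank ℂ (rowSpan M) = k ∧ plucker M ∈ T}

/-- The Waring rank over `K` of a binary form: the least `r` such that `f` is a sum of `r`
scalar multiples of `d`-th powers of linear forms. -/
def waringRank {K : Type} [Field K] (d : ℕ) (f : MvPolynomial (Fin 2) K) : ℕ :=
  sInf {r | ∃ (α u v : Fin r → K), f = ∑ i, α i • (linForm (u i) (v i)) ^ d}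

/-- The set of coefficient vectors of real binary forms of degree `d` of real rank `r`. -/
def realRankSet (d r : ℕ) : Set (Fin (d+1) → ℝ) :=
  {a | waringRank d (binForm d a) = r}

/-- `R_{d,r}`: the interior, in the Euclidean topology, of the set of real binary forms of
degree `d` and real rank `r`. -/
def Rdr (d r : ℕ) : Set (Fin (d+1) → ℝ) := interior (realRankSet d r)

/-- The topological boundary of `R_{d,r}`: the closure of `R_{d,r}` minus the interior of
the closure. -/
def topBoundary (d r : ℕ) : Set (Fin (d+1) → ℝ) :=
  closure (Rdr d r) \ interior (closure (Rdr d r))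

/-- The algebraic boundary `∂_alg(R_{d,r})`: the Zariski closure over `ℂ` of the topological
boundary of `R_{d,r}`. -/
def algBoundary (d r : ℕ) : Set (Fin (d+1) → ℂ) :=
  zClosure ((fun a i => ((a i : ℝ) : ℂ)) '' topBoundary d r)


/-- Vectors of coefficients of forms that are combinations of `r` powers. -/
def tSet (d r : ℕ) : Set (Fin (d+1) → ℝ) :=
  {a | ∃ α u v : Fin r → ℝ, ∀ k : Fin (d+1),
    a k = (d.choose k : ℝ) * ∑ j, α j * (u j ^ (d - (k : ℕ)) * v j ^ (k : ℕ))}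

/-- The functional on univariate polynomials attached to a binary form. -/
def lFun {d : ℕ} (a : Fin (d+1) → ℝ) (p : Polynomial ℝ) : ℝ :=
  ∑ k : Fin (d+1), a k / (d.choose k : ℝ) * p.coeff k

lemma choose_ne {d : ℕ} (k : Fin (d+1)) : (d.choose k : ℝ) ≠ 0 := by
  have := Nat.choose_pos (Nat.lt_succ_iff.mp k.2)
  positivity

lemma linForm_pow (d : ℕ) (u v : ℝ) : linForm u v ^ d =
    binForm d (fun k => (d.choose k : ℝ) * (u ^ (d - (k : ℕ)) * v ^ (k : ℕ))) := by
  unfold linForm binForm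
  rw [add_comm, add_pow, Finset.sum_range]
  refine Finset.sum_congr rfl fun k _ => ?_
  simp only [mul_pow, map_mul, map_pow, map_natCast]
  ring

lemma binForm_inj {d : ℕ} {a b : Fin (d+1) → ℝ} (h : binForm d a = binForm d b) : a = b := by
  have key : ∀ (c : Fin (d+1) → ℝ) (k : Fin (d+1)),
      (aeval ![(1 : Polynomial ℝ), Polynomial.X] (binForm d c)).coeff k = c k := by
    intro c k
    unfold binForm
    simp [Polynomial.finsetSum_coeff, Polynomial.coeff_X_pow,
      Fin.val_inj]
  funext k
  rw [← key a k, ← key b k, h]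

lemma waring_eq (d : ℕ) (a : Fin (d+1) → ℝ) :
    waringRank d (binForm d a) = sInf {r | a ∈ tSet d r} := by
  unfold waringRank tSet
  congr 1
  ext r
  simp only [Set.mem_ofPred_eq]
  refine exists_congr fun α => exists_congr fun u => exists_congr fun v => ?_
  have : ∑ i, α i • linForm (u i) (v i) ^ d = binForm d (fun k => (d.choose k : ℝ) *
      ∑ j, α j * (u j ^ (d - (k : ℕ)) * v j ^ (k : ℕ))) := by
    simp_rw [linForm_pow, binForm, Finset.smul_sum]
    rw [Finset.sum_comm]
    refine Finset.sum_congr rfl fun k _ => ?_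
    rw [map_mul, map_sum, Finset.mul_sum, Finset.sum_mul, Finset.sum_mul]
    refine Finset.sum_congr rfl fun j _ => ?_
    rw [MvPolynomial.smul_eq_C_mul]
    simp only [map_mul]
    ring
  rw [this]
  exact ⟨fun h k => congrFun (binForm_inj h) k, fun h => congrArg _ (funext h)⟩

lemma tSet_succ {d r : ℕ} : tSet d r ⊆ tSet d (r+1) := by
  rintro a ⟨α, u, v, h⟩
  refine ⟨Fin.snoc α 0, Fin.snoc u 0, Fin.snoc v 0, fun k => ?_⟩
  rw [h k, Fin.sum_univ_castSucc]
  simp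

lemma tSet_mono {d r s : ℕ} (h : r ≤ s) : tSet d r ⊆ tSet d s :=
  monotone_nat_of_le_succ (f := tSet d) (fun _ => tSet_succ) h

lemma lFun_X_pow {d : ℕ} (a : Fin (d+1) → ℝ) (k : Fin (d+1)) :
    lFun a (Polynomial.X ^ (k : ℕ)) = a k / (d.choose k : ℝ) := by
  simp [lFun, Polynomial.coeff_X_pow, Fin.val_inj]

lemma lFun_add {d : ℕ} (a : Fin (d+1) → ℝ) (p q : Polynomial ℝ) :
    lFun a (p + q) = lFun a p + lFun a q := by
  simp [lFun, mul_add, Finset.sum_add_distrib]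

lemma lFun_sub {d : ℕ} (a : Fin (d+1) → ℝ) (p q : Polynomial ℝ) :
    lFun a (p - q) = lFun a p - lFun a q := by
  simp [lFun, mul_sub, Finset.sum_sub_distrib]

lemma lFun_C_mul {d : ℕ} (a : Fin (d+1) → ℝ) (c : ℝ) (q : Polynomial ℝ) :
    lFun a (Polynomial.C c * q) = c * lFun a q := by
  simp only [lFun, Polynomial.coeff_C_mul, Finset.mul_sum]
  exact Finset.sum_congr rfl fun _ _ => by ring

lemma lFun_sum {d : ℕ} {ι : Type*} (s : Finset ι) (a : Fin (d+1) → ℝ) (q : ι → Polynomial ℝ) :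
    lFun a (∑ i ∈ s, q i) = ∑ i ∈ s, lFun a (q i) := by
  simp only [lFun, Polynomial.finsetSum_coeff, Finset.mul_sum]
  rw [Finset.sum_comm]

lemma mem_tSet_of_lFun {d r : ℕ} {a : Fin (d+1) → ℝ} (t α : Fin r → ℝ)
    (h : ∀ k : Fin (d+1), lFun a (Polynomial.X ^ (k : ℕ)) = ∑ j, α j * t j ^ (k : ℕ)) :
    a ∈ tSet d r := by
  refine ⟨α, fun _ => 1, t, fun k => ?_⟩
  have := h k
  rw [lFun_X_pow, div_eq_iff (choose_ne k)] at this
  rw [this, mul_comm]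
  simp

lemma mem_tSet_succ_d {d : ℕ} (a : Fin (d+1) → ℝ) : a ∈ tSet d (d+1) := by
  let t : Fin (d+1) → ℝ := fun i => (i : ℕ)
  have ht : Set.InjOn t (Finset.univ : Finset (Fin (d+1))) := by
    intro i _ j _ hij
    simpa [t, Fin.val_inj] using hij
  refine mem_tSet_of_lFun t (fun j => lFun a (Lagrange.basis Finset.univ t j)) fun k => ?_
  have hdeg : ((Polynomial.X : Polynomial ℝ) ^ (k : ℕ)).degree
      < (Finset.univ : Finset (Fin (d+1))).card := by
    rw [Polynomial.degree_X_pow, Finset.card_fin]; exact_mod_cast k.2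
  rw [Lagrange.eq_interpolate ht hdeg, Lagrange.interpolate_apply, lFun_sum]
  refine Finset.sum_congr rfl fun j _ => ?_
  rw [lFun_C_mul]; simp [mul_comm]

lemma mem_tSet_d_of_nodes {d : ℕ} (a : Fin (d+1) → ℝ) (t : Fin d → ℝ)
    (ht : Function.Injective t) (h0 : lFun a (∏ j, (Polynomial.X - Polynomial.C (t j))) = 0) :
    a ∈ tSet d d := by
  have ht' : Set.InjOn t (Finset.univ : Finset (Fin d)) := ht.injOn
  refine mem_tSet_of_lFun t (fun j => lFun a (Lagrange.basis Finset.univ t j)) fun k => ?_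
  have main : ∀ q : Polynomial ℝ, q.degree < (Finset.univ : Finset (Fin d)).card →
      lFun a q = ∑ j, lFun a (Lagrange.basis Finset.univ t j) * q.eval (t j) := by
    intro q hq
    conv_lhs => rw [Lagrange.eq_interpolate ht' hq, Lagrange.interpolate_apply, lFun_sum]
    refine Finset.sum_congr rfl fun j _ => ?_
    rw [lFun_C_mul]; simp [mul_comm]
  rcases Nat.lt_succ_iff_lt_or_eq.mp k.2 with hk | hk
  · rw [main _ (by rw [Polynomial.degree_X_pow]; simpa using hk)]
    simp
  · have h1 : lFun a (Polynomial.X ^ (k : ℕ)) = lFun a (Polynomial.X ^ (k : ℕ) -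
        Lagrange.nodal Finset.univ t) := by
      rw [lFun_sub, Lagrange.nodal_eq, h0, sub_zero]
    rw [h1, main]
    · refine Finset.sum_congr rfl fun j _ => ?_
      rw [Polynomial.eval_sub, Lagrange.eval_nodal_at_node (Finset.mem_univ j)]
      simp
    · have hn := Lagrange.degree_nodal (s := (Finset.univ : Finset (Fin d))) (v := t)
      rw [← hn, hk]
      rw [Finset.card_fin] at hn
      have := Polynomial.degree_sub_lt_left (p := (Polynomial.X : Polynomial ℝ) ^ d)
        (q := Lagrange.nodal Finset.univ t) (by rw [Polynomial.degree_X_pow, hn])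
        (by simp) (by rw [Polynomial.leadingCoeff_X_pow, (Lagrange.nodal_monic).leadingCoeff])
      rwa [Polynomial.degree_X_pow, ← hn] at this

lemma mem_tSet_of_scaled {d r : ℕ} (a : Fin (d+1) → ℝ) {ε : ℝ} (hε : ε ≠ 0)
    (h : (fun k : Fin (d+1) => a k * ε ^ (k : ℕ)) ∈ tSet d r) : a ∈ tSet d r := by
  obtain ⟨α, u, v, h⟩ := h
  refine ⟨α, u, fun j => v j / ε, fun k => ?_⟩
  have h1 := h k
  have h2 : a k = (a k * ε ^ (k : ℕ)) / ε ^ (k : ℕ) := by field_simp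
  rw [h2]
  simp only at h1
  rw [h1, mul_div_assoc, Finset.sum_div]
  congr 1
  refine Finset.sum_congr rfl fun j _ => ?_
  rw [div_pow]; ring

lemma mem_tSet_d {d : ℕ} (hd : 1 ≤ d) (a : Fin (d+1) → ℝ) (h0 : a 0 ≠ 0) : a ∈ tSet d d := by
  obtain ⟨n, rfl⟩ : ∃ n, d = n + 1 := ⟨d - 1, by omega⟩
  let sc : ℝ → Fin (n+1+1) → ℝ := fun ε k => a k * ε ^ (k : ℕ)
  let q : Polynomial ℝ := ∏ i : Fin n, (Polynomial.X - Polynomial.C ((i : ℕ) + 1 : ℝ))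
  have hcont : ∀ p : Polynomial ℝ, Continuous fun ε => lFun (sc ε) p := by
    intro p
    simp only [lFun, sc]
    fun_prop
  have hzero : ∀ p : Polynomial ℝ, lFun (sc 0) p = a 0 * p.coeff 0 := by
    intro p
    simp [lFun, sc, Fin.sum_univ_succ]
  have hA0 : lFun (sc 0) (q * Polynomial.X) = 0 := by simp [hzero]
  have hB0 : lFun (sc 0) q ≠ 0 := by
    rw [hzero]
    refine mul_ne_zero h0 ?_
    rw [Polynomial.coeff_zero_eq_eval_zero, Polynomial.eval_prod, Finset.prod_ne_zero_iff]
    intro i _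
    simp only [Polynomial.eval_sub, Polynomial.eval_X, Polynomial.eval_C, zero_sub]
    have : (0 : ℝ) < (i : ℕ) + 1 := by positivity
    exact neg_ne_zero.mpr (ne_of_gt this)
  have hev : ∀ᶠ ε in nhds (0 : ℝ), |lFun (sc ε) (q * Polynomial.X)| < |lFun (sc ε) q| := by
    refine (((hcont _).abs).tendsto 0).eventually_lt (((hcont _).abs).tendsto 0) ?_
    rw [hA0, abs_zero]
    exact abs_pos.mpr hB0
  obtain ⟨ε, hε, hε0⟩ := ((hev.filter_mono nhdsWithin_le_nhds).and
    (self_mem_nhdsWithin : {(0:ℝ)}ᶜ ∈ nhdsWithin (0 : ℝ) {0}ᶜ)).exists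
  set A := lFun (sc ε) (q * Polynomial.X) with hA
  set B := lFun (sc ε) q with hB
  have hBp : 0 < |B| := lt_of_le_of_lt (abs_nonneg _) hε
  have hBne : B ≠ 0 := abs_pos.mp hBp
  have hτ : A / B < 1 := by
    refine lt_of_le_of_lt (le_abs_self _) ?_
    rw [abs_div, div_lt_one hBp]
    exact hε
  refine mem_tSet_of_scaled a hε0 ?_
  refine mem_tSet_d_of_nodes (sc ε) (Fin.cons (A / B) fun i : Fin n => ((i : ℕ) + 1 : ℝ)) ?_ ?_
  · rw [Fin.cons_injective_iff]
    constructor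
    · rintro ⟨i, hi⟩
      simp only at hi
      have : (0 : ℝ) ≤ (i : ℕ) := by positivity
      linarith
    · intro i j hij
      simpa [Fin.val_inj] using hij
  · rw [Fin.prod_univ_succ]
    simp only [Fin.cons_zero, Fin.cons_succ]
    have : (Polynomial.X - Polynomial.C (A / B)) *
        ∏ i : Fin n, (Polynomial.X - Polynomial.C ((i : ℕ) + 1 : ℝ))
        = q * Polynomial.X - Polynomial.C (A / B) * q := by
      simp only [q]; ring
    rw [this, lFun_sub, lFun_C_mul, ← hA, ← hB]
    field_simp
    ring

/-- The Hankel matrix. -/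
def hankel {d r : ℕ} (h : 2 * r ≤ d) (a : Fin (d+1) → ℝ) : Matrix (Fin (r+1)) (Fin (r+1)) ℝ :=
  Matrix.of fun i j =>
    a ⟨(i : ℕ) + (j : ℕ), by omega⟩ / (d.choose ((i : ℕ) + (j : ℕ)) : ℝ)

lemma det_hankel {d r : ℕ} (h : 2 * r ≤ d) {a : Fin (d+1) → ℝ} (ha : a ∈ tSet d r) :
    (hankel h a).det = 0 := by
  obtain ⟨α, u, v, ha⟩ := ha
  let A : Matrix (Fin (r+1)) (Fin r) ℝ :=
    Matrix.of fun i j => α j * (u j ^ (r - (i : ℕ)) * v j ^ (i : ℕ))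
  let B : Matrix (Fin r) (Fin (r+1)) ℝ :=
    Matrix.of fun j k => u j ^ (d - r - (k : ℕ)) * v j ^ (k : ℕ)
  have hAB : hankel h a = A * B := by
    ext i k
    rw [Matrix.mul_apply]
    simp only [hankel, A, B, Matrix.of_apply]
    rw [ha, mul_div_assoc, mul_div_cancel₀]
    · refine Finset.sum_congr rfl fun j _ => ?_
      have e : d - ((i : ℕ) + (k : ℕ)) = (r - (i : ℕ)) + (d - r - (k : ℕ)) := by omega
      simp only [e, pow_add]
      ring
    · exact choose_ne (⟨(i : ℕ) + (k : ℕ), by omega⟩ : Fin (d+1))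
  by_contra hne
  have hu : IsUnit (hankel h a) := (Matrix.isUnit_iff_isUnit_det _).mpr (isUnit_iff_ne_zero.mpr hne)
  have h1 := Matrix.rank_of_isUnit _ hu
  have h2 := Matrix.rank_mul_le_left A B
  have h3 := Matrix.rank_le_width A
  rw [hAB] at h1
  simp at h1
  omega

lemma not_nhds_tSet {d r : ℕ} (h : 2 * r ≤ d) (a : Fin (d+1) → ℝ) : tSet d r ∉ nhds a := by
  intro hn
  let J : Matrix (Fin (r+1)) (Fin (r+1)) ℝ := Matrix.of fun i j => if i = Fin.rev j then 1 else 0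
  let e : Fin (d+1) → ℝ := fun k => if (k : ℕ) = r then (d.choose k : ℝ) else 0
  have hJJ : J * J = 1 := by
    ext i k
    rw [Matrix.mul_apply]
    simp [J, Matrix.one_apply]
  have hH : ∀ s : ℝ, hankel h (a + s • e) = hankel h a + s • J := by
    intro s
    ext i k
    simp only [hankel, Matrix.of_apply, Pi.add_apply, Pi.smul_apply, smul_eq_mul, Matrix.add_apply,
      Matrix.smul_apply, add_div, e, J]
    congr 1
    have hc : (d.choose ((i : ℕ) + (k : ℕ)) : ℝ) ≠ 0 :=
      choose_ne (⟨(i : ℕ) + (k : ℕ), by omega⟩ : Fin (d+1))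
    by_cases hik : (i : ℕ) + (k : ℕ) = r
    · have : i = Fin.rev k := by ext; simp [Fin.val_rev]; omega
      rw [if_pos hik, if_pos this]; field_simp
    · have : ¬ i = Fin.rev k := by
        intro h; apply hik; rw [h, Fin.val_rev]; omega
      rw [if_neg hik, if_neg this]; simp
  have hroot : ∀ s : ℝ, (hankel h (a + s • e)).det = 0 →
      (-(hankel h a * J)).charpoly.eval s = 0 := by
    intro s hs
    rw [Matrix.eval_charpoly]
    have : (Matrix.scalar (Fin (r+1))) s - -(hankel h a * J) = hankel h (a + s • e) * J := by
      rw [hH, add_mul, Matrix.smul_mul, hJJ, sub_neg_eq_add, Matrix.smul_one_eq_diagonal,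
        add_comm (hankel h a * J)]
      rfl
    rw [this, Matrix.det_mul, hs, zero_mul]
  have hcont : Continuous fun s : ℝ => a + s • e := by fun_prop
  have hev : ∀ᶠ s in nhds (0 : ℝ), a + s • e ∈ tSet d r := by
    have := hcont.tendsto 0
    rw [zero_smul, add_zero] at this
    exact this hn
  have hinf : Set.Infinite {s : ℝ | (-(hankel h a * J)).charpoly.IsRoot s} := by
    refine infinite_of_mem_nhds (0 : ℝ) ?_
    filter_upwards [hev] with s hs
    exact hroot s (det_hankel h hs)
  exact (Matrix.charpoly_monic _).ne_zero (Polynomial.eq_zero_of_infinite_isRoot _ hinf)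

/-- The real-rooted polynomial attached to a family of angles. -/
def hPoly {s : ℕ} (θ : Fin s → ℝ) : Polynomial ℝ :=
  ∏ j, (Polynomial.C (Real.sin (θ j)) - Polynomial.C (Real.cos (θ j)) * Polynomial.X)

lemma natDegree_hfac (x y : ℝ) :
    (Polynomial.C x - Polynomial.C y * Polynomial.X : Polynomial ℝ).natDegree ≤ 1 := by
  compute_degree

lemma hom_eval_zero {d : ℕ} (p : Polynomial ℝ) (hp : p.natDegree < d) (u v U V : ℝ)
    (h : u * V = v * U) :
    ∑ k : Fin (d+1), u ^ (d - (k : ℕ)) * v ^ (k : ℕ) *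
      ((Polynomial.C V - Polynomial.C U * Polynomial.X) * p).coeff k = 0 := by
  obtain ⟨n, rfl⟩ : ∃ n, d = n + 1 := ⟨d - 1, by omega⟩
  have e : ∀ k : ℕ, ((Polynomial.C V - Polynomial.C U * Polynomial.X) * p).coeff k =
      V * p.coeff k - U * (Polynomial.X * p).coeff k := by
    intro k
    rw [sub_mul, mul_assoc, Polynomial.coeff_sub, Polynomial.coeff_C_mul, Polynomial.coeff_C_mul]
  simp only [e]
  rw [Fin.sum_univ_eq_sum_range (fun k => u ^ (n + 1 - k) * v ^ k *
      (V * p.coeff k - U * (Polynomial.X * p : Polynomial ℝ).coeff k)) (n + 1 + 1)]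
  simp only [mul_sub, Finset.sum_sub_distrib]
  rw [Finset.sum_range_succ, Finset.sum_range_succ' (n := n + 1),
    Polynomial.coeff_eq_zero_of_natDegree_lt hp, Polynomial.coeff_X_mul_zero]
  simp only [mul_zero, add_zero, Polynomial.coeff_X_mul]
  rw [← Finset.sum_sub_distrib]
  refine Finset.sum_eq_zero fun k hk => ?_
  have hk' : k < n + 1 := Finset.mem_range.mp hk
  have e1 : n + 1 - k = (n + 1 - (k + 1)) + 1 := by omega
  rw [e1, pow_succ, pow_succ]
  linear_combination (u ^ (n + 1 - (k + 1)) * v ^ k * p.coeff k) * h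

lemma exists_angles {d s : ℕ} (hs : s ≤ d) {a : Fin (d+1) → ℝ} (ha : a ∈ tSet d s) :
    ∃ θ ∈ Set.univ.pi (fun _ : Fin s => Set.Icc (-Real.pi) Real.pi), ∀ m ≤ d - s,
      lFun a (Polynomial.X ^ m * hPoly θ) = 0 := by
  obtain ⟨α, u, v, ha⟩ := ha
  refine ⟨fun j => Complex.arg ⟨u j, v j⟩, ?_, ?_⟩
  · intro j _
    exact ⟨(Complex.neg_pi_lt_arg _).le, Complex.arg_le_pi _⟩
  · intro m hm
    set θ : Fin s → ℝ := fun j => Complex.arg ⟨u j, v j⟩ with hθ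
    have huv : ∀ j, u j * Real.sin (θ j) = v j * Real.cos (θ j) := by
      intro j
      have h1 := Complex.norm_mul_cos_arg ⟨u j, v j⟩
      have h2 := Complex.norm_mul_sin_arg ⟨u j, v j⟩
      simp only at h1 h2
      simp only [hθ]
      linear_combination (-Real.sin (Complex.arg ⟨u j, v j⟩)) * h1 +
        Real.cos (Complex.arg ⟨u j, v j⟩) * h2
    have hform : ∀ q : Polynomial ℝ, lFun a q = ∑ j, α j * ∑ k : Fin (d+1),
        u j ^ (d - (k : ℕ)) * v j ^ (k : ℕ) * q.coeff k := by
      intro q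
      unfold lFun
      simp only [Finset.mul_sum]
      rw [Finset.sum_comm]
      refine Finset.sum_congr rfl fun k _ => ?_
      rw [ha k, mul_div_cancel_left₀ _ (choose_ne k), Finset.sum_mul]
      exact Finset.sum_congr rfl fun _ _ => by ring
    rw [hform]
    refine Finset.sum_eq_zero fun j _ => ?_
    have hfac : Polynomial.X ^ m * hPoly θ = (Polynomial.C (Real.sin (θ j)) -
        Polynomial.C (Real.cos (θ j)) * Polynomial.X) * (Polynomial.X ^ m *
        ∏ i ∈ Finset.univ.erase j, (Polynomial.C (Real.sin (θ i)) -
          Polynomial.C (Real.cos (θ i)) * Polynomial.X)) := by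
      unfold hPoly
      rw [← Finset.mul_prod_erase Finset.univ _ (Finset.mem_univ j)]
      ring
    rw [hfac, hom_eval_zero _ _ _ _ _ _ (huv j), mul_zero]
    have hd1 : (∏ i ∈ Finset.univ.erase j, (Polynomial.C (Real.sin (θ i)) -
          Polynomial.C (Real.cos (θ i)) * Polynomial.X)).natDegree ≤ s - 1 := by
      refine (Polynomial.natDegree_prod_le _ _).trans ?_
      refine (Finset.sum_le_sum fun i _ => natDegree_hfac _ _).trans ?_
      simp [Finset.card_erase_of_mem]
    have hspos : 0 < s := j.pos
    refine lt_of_le_of_lt (Polynomial.natDegree_mul_le) ?_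
    rw [Polynomial.natDegree_X_pow]
    omega

lemma continuous_hcoeff {s : ℕ} (S : Finset (Fin s)) (k : ℕ) : Continuous fun θ : Fin s → ℝ =>
    (∏ j ∈ S, (Polynomial.C (Real.sin (θ j)) -
      Polynomial.C (Real.cos (θ j)) * Polynomial.X)).coeff k := by
  induction S using Finset.induction_on generalizing k with
  | empty => simpa only [Finset.prod_empty] using continuous_const
  | insert i S hi ih =>
    simp only [Finset.prod_insert hi, Polynomial.coeff_mul]
    refine continuous_finsetSum _ fun x _ => Continuous.mul ?_ (ih _)
    simp only [Polynomial.coeff_sub, Polynomial.coeff_C_mul, Polynomial.coeff_C]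
    split_ifs <;> fun_prop

lemma continuous_lFun_h {d s : ℕ} (m : ℕ) : Continuous fun z : (Fin (d+1) → ℝ) × (Fin s → ℝ) =>
    lFun z.1 (Polynomial.X ^ m * hPoly z.2) := by
  unfold lFun hPoly
  refine continuous_finsetSum _ fun k _ => Continuous.mul (by fun_prop) ?_
  simp only [Polynomial.coeff_X_pow_mul']
  split_ifs
  · exact (continuous_hcoeff Finset.univ ((k : ℕ) - m)).comp continuous_snd
  · exact continuous_const

lemma compl_tSet_mem_nhds {d s : ℕ} (hs : s ≤ d) (a : Fin (d+1) → ℝ)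
    (h : ∀ θ : Fin s → ℝ, ∃ m ≤ d - s, lFun a (Polynomial.X ^ m * hPoly θ) ≠ 0) :
    ∀ᶠ b in nhds a, b ∉ tSet d s := by
  have hK : IsCompact (Set.univ.pi (fun _ : Fin s => Set.Icc (-Real.pi) Real.pi)) :=
    isCompact_univ_pi fun _ => isCompact_Icc
  have := hK.eventually_forall_of_forall_eventually (x₀ := a)
    (P := fun b θ => ∃ m ≤ d - s, lFun b (Polynomial.X ^ m * hPoly θ) ≠ 0) (by
      intro θ _
      obtain ⟨m, hm, hne⟩ := h θ
      have := ((continuous_lFun_h (d := d) (s := s) m).continuousAt (x := (a, θ))).eventually_ne hne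
      filter_upwards [this] with z hz
      exact ⟨m, hm, hz⟩)
  filter_upwards [this] with b hb hmem
  obtain ⟨θ, hθ, hall⟩ := exists_angles hs hmem
  obtain ⟨m, hm, hne⟩ := hb θ hθ
  exact hne (hall m hm)

/-- The point with given weights and nodes. -/
def phiPt {r : ℕ} (d : ℕ) (x : (Fin r → ℝ) × (Fin r → ℝ)) : Fin (d+1) → ℝ :=
  fun k => (d.choose k : ℝ) * ∑ j, x.1 j * x.2 j ^ (k : ℕ)

lemma phiPt_mem {d r : ℕ} (x : (Fin r → ℝ) × (Fin r → ℝ)) : phiPt d x ∈ tSet d r :=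
  ⟨x.1, fun _ => 1, x.2, fun k => by simp [phiPt]⟩

lemma lFun_phiPt {d r : ℕ} (x : (Fin r → ℝ) × (Fin r → ℝ)) (q : Polynomial ℝ)
    (hq : q.natDegree ≤ d) : lFun (phiPt d x) q = ∑ j, x.1 j * q.eval (x.2 j) := by
  unfold lFun phiPt
  simp only [Polynomial.eval_eq_sum_range' (Nat.lt_succ_of_le hq), Finset.mul_sum]
  rw [Finset.sum_comm, ← Fin.sum_univ_eq_sum_range
    (fun k => ∑ j, x.1 j * (q.coeff k * x.2 j ^ k)) (d+1)]
  refine Finset.sum_congr rfl fun k _ => ?_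
  rw [← Finset.mul_sum, mul_div_cancel_left₀ _ (choose_ne k), Finset.sum_mul]
  exact Finset.sum_congr rfl fun _ _ => by ring

/-- The weights. -/
def wts (r : ℕ) : Fin r → ℝ := fun i =>
  (1 / ∏ j ∈ Finset.univ.erase i, (((i : ℕ) : ℝ) - ((j : ℕ) : ℝ))) / (1 + ((i : ℕ) : ℝ) ^ 2)

/-- The nodes. -/
def nds (r : ℕ) : Fin r → ℝ := fun i => ((i : ℕ) : ℝ)

lemma nds_inj (r : ℕ) : Function.Injective (nds r) := fun i j h => by
  simpa [nds, Fin.val_inj] using h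

lemma wts_ne (r : ℕ) (i : Fin r) : wts r i ≠ 0 := by
  unfold wts
  have h1 : (1 + ((i : ℕ) : ℝ) ^ 2) ≠ 0 := by positivity
  refine div_ne_zero (one_div_ne_zero ?_) h1
  rw [Finset.prod_ne_zero_iff]
  intro j hj
  rw [sub_ne_zero]
  intro h
  exact (Finset.ne_of_mem_erase hj) (nds_inj r h).symm

lemma hPoly_aeval_ne {s : ℕ} (θ : Fin s → ℝ) : Polynomial.aeval Complex.I (hPoly θ) ≠ 0 := by
  unfold hPoly
  rw [map_prod, Finset.prod_ne_zero_iff]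
  intro j _ h
  simp only [map_sub, map_mul, Polynomial.aeval_C, Polynomial.aeval_X, Complex.coe_algebraMap] at h
  have h1 := congrArg Complex.re h
  have h2 := congrArg Complex.im h
  simp only [Complex.sub_re, Complex.sub_im, Complex.mul_re, Complex.mul_im, Complex.ofReal_re,
    Complex.ofReal_im, Complex.I_re, Complex.I_im, Complex.zero_re, Complex.zero_im] at h1 h2
  have := Real.sin_sq_add_cos_sq (θ j)
  nlinarith

lemma key_nonvanish {d s : ℕ} (h2 : s + 1 ≤ d) (θ : Fin s → ℝ) :
    ∃ m ≤ d - s, lFun (phiPt d (wts (s+1), nds (s+1))) (Polynomial.X ^ m * hPoly θ) ≠ 0 := by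
  by_contra hcon
  push Not at hcon
  have hdegh : (hPoly θ).natDegree ≤ s := by
    unfold hPoly
    refine (Polynomial.natDegree_prod_le _ _).trans ?_
    refine (Finset.sum_le_sum fun i _ => natDegree_hfac _ _).trans ?_
    simp
  have hinj : Set.InjOn (nds (s+1)) (Finset.univ : Finset (Fin (s+1))) := (nds_inj _).injOn
  let Q := Lagrange.interpolate Finset.univ (nds (s+1))
    (fun i => (hPoly θ).eval (nds (s+1) i) / (1 + nds (s+1) i ^ 2))
  have hQev : ∀ i, Q.eval (nds (s+1) i) = (hPoly θ).eval (nds (s+1) i) / (1 + nds (s+1) i ^ 2) :=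
    fun i => Lagrange.eval_interpolate_at_node _ hinj (Finset.mem_univ i)
  have hQdeg : Q.degree < (s + 1 : ℕ) := by
    have := Lagrange.degree_interpolate_lt
      (fun i => (hPoly θ).eval (nds (s+1) i) / (1 + nds (s+1) i ^ 2)) hinj
    rwa [Finset.card_fin] at this
  have hsmall : Q = 0 ∨ Q.natDegree + (d - s) < s := by
    by_contra hc
    push Not at hc
    obtain ⟨hQ0, hbig⟩ := hc
    have hQn : Q.natDegree < s + 1 := (Polynomial.natDegree_lt_iff_degree_lt hQ0).mpr hQdeg
    have hm := hcon (s - Q.natDegree) (by omega)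
    rw [lFun_phiPt _ _ (by
      refine Polynomial.natDegree_mul_le.trans ?_
      rw [Polynomial.natDegree_X_pow]
      omega)] at hm
    have hP : (Polynomial.X ^ (s - Q.natDegree) * Q : Polynomial ℝ).degree
        < ((Finset.univ : Finset (Fin (s+1))).card : WithBot ℕ) := by
      refine lt_of_le_of_lt Polynomial.degree_le_natDegree ?_
      rw [Finset.card_fin]
      have := Polynomial.natDegree_mul_le (p := Polynomial.X ^ (s - Q.natDegree)) (q := Q)
      rw [Polynomial.natDegree_X_pow] at this
      exact_mod_cast (by omega)
    have hco := Lagrange.coeff_eq_sum hinj hP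
    rw [Finset.card_fin, Nat.add_sub_cancel, Polynomial.coeff_X_pow_mul', if_pos (by omega)] at hco
    have e : s - (s - Q.natDegree) = Q.natDegree := by omega
    rw [e] at hco
    apply hQ0
    rw [← Polynomial.leadingCoeff_eq_zero, Polynomial.leadingCoeff, hco, ← hm]
    refine Finset.sum_congr rfl fun i _ => ?_
    simp only [Polynomial.eval_mul, Polynomial.eval_pow, Polynomial.eval_X, hQev, wts]
    simp only [nds]
    ring
  have hmul : hPoly θ = (1 + Polynomial.X ^ 2) * Q := by
    refine Polynomial.eq_of_degrees_lt_of_eval_index_eq (s := Finset.univ) (v := nds (s+1)) hinj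
      ?_ ?_ ?_
    · refine lt_of_le_of_lt Polynomial.degree_le_natDegree ?_
      rw [Finset.card_fin]
      exact_mod_cast (by omega)
    · rcases hsmall with h | h
      · rw [h]; simp
      · refine lt_of_le_of_lt Polynomial.degree_le_natDegree ?_
        rw [Finset.card_fin]
        have h3 := Polynomial.natDegree_mul_le (p := (1 + Polynomial.X ^ 2 : Polynomial ℝ)) (q := Q)
        have h4 : (1 + Polynomial.X ^ 2 : Polynomial ℝ).natDegree ≤ 2 := by compute_degree
        exact_mod_cast (by omega)
    · intro i _
      have : (1 + nds (s+1) i ^ 2) ≠ 0 := by positivity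
      simp only [Polynomial.eval_mul, Polynomial.eval_add, Polynomial.eval_pow, Polynomial.eval_X,
        Polynomial.eval_one, hQev]
      field_simp
  refine hPoly_aeval_ne θ ?_
  rw [hmul]
  simp

lemma poly_zero_of_double {r d : ℕ} (h : d + 1 ≤ 2 * r) (t : Fin r → ℝ)
    (ht : Function.Injective t) (P : Polynomial ℝ) (hP : P.natDegree ≤ d)
    (h0 : ∀ i, P.eval (t i) = 0) (h1 : ∀ i, P.derivative.eval (t i) = 0) : P = 0 := by
  by_contra hne
  have hdvd : ∏ i, (Polynomial.X - Polynomial.C (t i)) ^ 2 ∣ P := by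
    refine Finset.prod_dvd_of_coprime ?_ ?_
    · intro i _ j _ hij
      exact (Polynomial.isCoprime_X_sub_C_of_isUnit_sub
        (isUnit_iff_ne_zero.mpr (sub_ne_zero.mpr (ht.ne hij)))).pow
    · intro i _
      exact (Polynomial.le_rootMultiplicity_iff hne).mp
        ((Polynomial.one_lt_rootMultiplicity_iff_isRoot hne).mpr ⟨h0 i, h1 i⟩)
  have := Polynomial.natDegree_le_of_dvd hdvd hne
  rw [Polynomial.natDegree_prod_of_monic _ _ fun i _ => (Polynomial.monic_X_sub_C _).pow 2] at this
  simp at this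
  omega

lemma tSet_mem_nhds {r d : ℕ} (h : d + 1 ≤ 2 * r) (x : (Fin r → ℝ) × (Fin r → ℝ))
    (hα : ∀ i, x.1 i ≠ 0) (ht : Function.Injective x.2) : tSet d r ∈ nhds (phiPt d x) := by
  let pr1 : Fin r → ((Fin r → ℝ) × (Fin r → ℝ) →L[ℝ] ℝ) := fun j =>
    (ContinuousLinearMap.proj j).comp (ContinuousLinearMap.fst ℝ _ _)
  let pr2 : Fin r → ((Fin r → ℝ) × (Fin r → ℝ) →L[ℝ] ℝ) := fun j =>
    (ContinuousLinearMap.proj j).comp (ContinuousLinearMap.snd ℝ _ _)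
  let D : (Fin r → ℝ) × (Fin r → ℝ) →L[ℝ] (Fin (d+1) → ℝ) := ContinuousLinearMap.pi fun k =>
    (d.choose k : ℝ) • ∑ j, (x.1 j • (((k : ℕ) * x.2 j ^ ((k : ℕ) - 1)) • pr2 j)
      + x.2 j ^ (k : ℕ) • pr1 j)
  have hD : HasStrictFDerivAt (phiPt d) D x := by
    rw [hasStrictFDerivAt_pi']
    intro k
    have h1 : ∀ j, HasStrictFDerivAt (fun y : (Fin r → ℝ) × (Fin r → ℝ) => y.1 j) (pr1 j) x :=
      fun j => (pr1 j).hasStrictFDerivAt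
    have h2 : ∀ j, HasStrictFDerivAt (fun y : (Fin r → ℝ) × (Fin r → ℝ) => y.2 j) (pr2 j) x :=
      fun j => (pr2 j).hasStrictFDerivAt
    have h3 := (HasStrictFDerivAt.fun_sum (u := Finset.univ) fun j _ =>
      (h1 j).mul ((h2 j).pow (k : ℕ))).const_mul (d.choose k : ℝ)
    have h4 : (ContinuousLinearMap.proj k).comp D = (d.choose k : ℝ) • ∑ i,
        (x.1 i • ((k : ℕ) • x.2 i ^ ((k : ℕ) - 1)) • pr2 i + x.2 i ^ (k : ℕ) • pr1 i) := by
      simp only [nsmul_eq_mul]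
      rfl
    rw [h4]
    exact h3
  have hDapp : ∀ y k, D y k = (d.choose k : ℝ) * ∑ j, (x.1 j * (((k : ℕ) * x.2 j ^ ((k : ℕ) - 1))
      * y.2 j) + x.2 j ^ (k : ℕ) * y.1 j) := by
    intro y k
    simp [D, pr1, pr2]
  have hsurj : (D : (Fin r → ℝ) × (Fin r → ℝ) →ₗ[ℝ] (Fin (d+1) → ℝ)).range = ⊤ := by
    by_contra hlt
    obtain ⟨φ, hφ0, hφ⟩ := Submodule.exists_le_ker_of_lt_top _ (lt_top_iff_ne_top.mpr hlt)
    have hφD : ∀ y, φ (D y) = 0 := fun y => hφ ⟨y, rfl⟩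
    let c : Fin (d+1) → ℝ := fun k => φ (Pi.single k 1)
    have hφe : ∀ z, φ z = ∑ k, z k * c k := by
      intro z
      rw [LinearMap.pi_apply_eq_sum_univ φ z]
      refine Finset.sum_congr rfl fun k _ => ?_
      simp only [smul_eq_mul, c]
      congr 2
      funext j
      simp [Pi.single_apply, eq_comm]
    let P : Polynomial ℝ := ∑ k : Fin (d+1), Polynomial.C (c k * (d.choose k : ℝ)) *
      Polynomial.X ^ (k : ℕ)
    have hP : P = 0 := by
      refine poly_zero_of_double h x.2 ht P ?_ ?_ ?_
      · refine Polynomial.natDegree_sum_le_of_forall_le _ _ fun k _ => ?_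
        exact (Polynomial.natDegree_C_mul_X_pow_le _ _).trans (Nat.lt_succ_iff.mp k.2)
      · intro i
        have := hφD (Pi.single i 1, 0)
        rw [hφe] at this
        simp only [hDapp] at this
        rw [← this]
        simp only [P, Polynomial.eval_finsetSum]
        refine Finset.sum_congr rfl fun k _ => ?_
        simp [Pi.single_apply]
        ring
      · intro i
        have := hφD (0, Pi.single i 1)
        rw [hφe] at this
        simp only [hDapp] at this
        refine (mul_eq_zero.mp (?_ : x.1 i * _ = 0)).resolve_left (hα i)
        rw [← this]
        simp only [P, Polynomial.derivative_sum, Polynomial.eval_finsetSum, Finset.mul_sum]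
        refine Finset.sum_congr rfl fun k _ => ?_
        simp [Pi.single_apply, Polynomial.derivative_X_pow]
        ring
    apply hφ0
    ext k
    have hck : P.coeff k = c k * (d.choose k : ℝ) := by
      simp only [P, Polynomial.finsetSum_coeff, Polynomial.coeff_C_mul, Polynomial.coeff_X_pow]
      simp [Fin.val_inj]
    rw [hP, Polynomial.coeff_zero] at hck
    have := (mul_eq_zero.mp hck.symm).resolve_right (choose_ne k)
    simpa [c] using this
  rw [← hD.map_nhds_eq_of_surj hsurj]
  exact Filter.Eventually.of_forall (f := nhds x) (p := fun y => phiPt d y ∈ tSet d r)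
    fun y => phiPt_mem y

lemma typical_of_le (d r : ℕ) (h1 : d + 1 ≤ 2 * r) (h2 : r ≤ d) : (Rdr d r).Nonempty := by
  obtain ⟨s, rfl⟩ : ∃ s, r = s + 1 := ⟨r - 1, by omega⟩
  refine ⟨phiPt d (wts (s+1), nds (s+1)), ?_⟩
  rw [Rdr, mem_interior_iff_mem_nhds]
  filter_upwards [tSet_mem_nhds h1 (wts (s+1), nds (s+1)) (wts_ne _) (nds_inj _),
    compl_tSet_mem_nhds (by omega : s ≤ d) _ (key_nonvanish h2)] with b hb hb'
  change waringRank d (binForm d b) = s + 1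
  rw [waring_eq]
  refine le_antisymm (Nat.sInf_le hb) ?_
  refine le_csInf ⟨_, hb⟩ fun n hn => ?_
  by_contra hlt
  exact hb' (tSet_mono (by omega : n ≤ s) hn)

lemma le_of_typical (d r : ℕ) (hd : 1 ≤ d) (h : (Rdr d r).Nonempty) :
    d + 1 ≤ 2 * r ∧ r ≤ d := by
  obtain ⟨a, ha⟩ := h
  rw [Rdr, mem_interior_iff_mem_nhds] at ha
  have hrank : ∀ b ∈ realRankSet d r, sInf {r | b ∈ tSet d r} = r := fun b hb => by
    rw [← waring_eq]; exact hb
  constructor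
  · by_contra hc
    refine not_nhds_tSet (by omega : 2 * r ≤ d) a ?_
    filter_upwards [ha] with b hb
    have := Nat.sInf_mem (s := {r | b ∈ tSet d r}) ⟨d + 1, mem_tSet_succ_d b⟩
    rw [hrank b hb] at this
    exact this
  · have hcont : Continuous fun s : ℝ => Function.update a 0 (a 0 + s) := by fun_prop
    have hev : ∀ᶠ s in nhds (0 : ℝ), Function.update a 0 (a 0 + s) ∈ realRankSet d r := by
      have := hcont.tendsto 0
      simp only [add_zero, Function.update_eq_self] at this
      exact this ha
    have hne : ∀ᶠ s in nhdsWithin (0 : ℝ) {0}ᶜ, a 0 + s ≠ 0 := by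
      by_cases h0 : a 0 = 0
      · filter_upwards [self_mem_nhdsWithin] with s hs
        simpa [h0] using hs
      · have : ContinuousAt (fun s : ℝ => a 0 + s) 0 := by fun_prop
        exact (this.eventually_ne (by simpa using h0)).filter_mono nhdsWithin_le_nhds
    obtain ⟨s, hs1, hs2⟩ := ((hev.filter_mono nhdsWithin_le_nhds).and hne).exists
    have := Nat.sInf_le (s := {r | Function.update a 0 (a 0 + s) ∈ tSet d r}) (m := d)
      (mem_tSet_d hd _ (by simpa using hs2))
    rw [hrank _ hs1] at this
    exact this

/-- a rank `r` is typical for real binary forms of degree `d ≥ 1`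
(i.e. the interior of the set of forms of real rank `r` is nonempty) iff
`(d+1)/2 ≤ r ≤ d`. -/
theorem typical_ranks_real_binary (d r : ℕ) (hd : 1 ≤ d) :
    (Rdr d r).Nonempty ↔ (d + 1 ≤ 2 * r ∧ r ≤ d) := by
  exact ⟨le_of_typical d r hd, fun h => typical_of_le d r h.1 h.2⟩
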